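/- Suppose E ∈ C¹(X,ℝ), let p be a peak selection of E with respect to L, and let {v_k} ⊆ V_0 and {w_k = p(v_k)} be sequences generated by the normalized GLL-type nonmonotone LMM (Algorithm 3), with E_k = E(w_k) and g_k = ∇E(w_k). Set K = {μ_j − 1 : j = 1, 2, …}, where μ_0 = 0 and μ_j ∈ {(j−1)M+1,…,jM} satisfies E_{μ_j} = max{E_{(j−1)M+1},…,E_{jM}}. Assume (i) p is continuous on V_0, (ii) t_k ≥ δ for some δ > 0 and all k ∈ K, and (iii) inf_{j≥0} E_{μ_j} > −∞. Then: (a) ∑_{k∈K} α_k ‖g_k‖² < ∞; (b) every accumulation point of {w_k}_{k∈K} is a critical point of E not belonging to L; and (c) if the whole sequence {w_k}_{k=0}^∞ converges to a point u_*, then u_* ∉ L and E'(u_*) = 0. -/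

import Mathlib

open Filter Topology Set
open scoped RealInnerProductSpace ENNReal

noncomputable section

/-- The half subspace `[L, v] = {t • v + w : t ≥ 0, w ∈ L}`. -/
def halfspaceCone {X : Type*} [NormedAddCommGroup X] [InnerProductSpace ℝ X]
    (L : Submodule ℝ X) (v : X) : Set X :=
  {y | ∃ t : ℝ, 0 ≤ t ∧ ∃ w ∈ (L : Set X), y = t • v + w}

/-- The normalized gradient-step map `v(α) = (v - α g)/‖v - α g‖`. -/
def stepv {X : Type*} [NormedAddCommGroup X] [InnerProductSpace ℝ X] (v g : X) (α : ℝ) : X :=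
  ‖v - α • g‖⁻¹ • (v - α • g)

/-- The set `V₀ = {v = v⊥ + τ v₀^L ∈ S : v⊥ ∈ L⊥, 0 ≤ τ ≤ 1}`. -/
def V0 {X : Type*} [NormedAddCommGroup X] [InnerProductSpace ℝ X]
    (L : Submodule ℝ X) (v0L : X) : Set X :=
  {v | ‖v‖ = 1 ∧ ∃ w ∈ (Lᗮ : Set X), ∃ τ : ℝ, 0 ≤ τ ∧ τ ≤ 1 ∧ v = w + τ • v0L}

section LocalMinimax

variable {X : Type*} [NormedAddCommGroup X] [InnerProductSpace ℝ X]

/-- At a local maximizer the gradient is nonpositive along every ray that stays in the set. -/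
lemma IsLocalMaxOn.inner_gradient_nonpos [CompleteSpace X] {E : X → ℝ} {s : Set X} {x φ : X}
    (h : IsLocalMaxOn E s x) (hE : DifferentiableAt ℝ E x)
    (hs : ∀ c : ℝ, 0 ≤ c → x + c • φ ∈ s) : ⟪gradient E x, φ⟫ ≤ 0 := by
  have hφ : φ ∈ posTangentConeAt s x := by
    apply mem_posTangentConeAt_of_segment_subset
    rw [segment_eq_image']
    rintro _ ⟨c, hc, rfl⟩
    simpa using hs c hc.1
  have := h.hasFDerivWithinAt_nonpos hE.hasFDerivAt.hasFDerivWithinAt hφ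
  rwa [gradient, InnerProductSpace.toDual_symm_apply]

lemma add_smul_mem_halfspaceCone {L : Submodule ℝ X} {u x φ : X} (hx : x ∈ halfspaceCone L u)
    (hφ : φ ∈ L) : x + φ ∈ halfspaceCone L u := by
  obtain ⟨t, ht, w, hw, rfl⟩ := hx
  exact ⟨t, ht, w + φ, L.add_mem hw hφ, by abel⟩

lemma gradient_mem_orthogonal_of_isLocalMaxOn [CompleteSpace X] {E : X → ℝ} {L : Submodule ℝ X}
    {u x : X} (hx : x ∈ halfspaceCone L u) (h : IsLocalMaxOn E (halfspaceCone L u) x)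
    (hE : DifferentiableAt ℝ E x) : gradient E x ∈ Lᗮ := by
  rw [Submodule.mem_orthogonal']
  have key : ∀ φ ∈ L, ⟪gradient E x, φ⟫ ≤ 0 := fun φ hφ =>
    h.inner_gradient_nonpos hE fun c _ => add_smul_mem_halfspaceCone hx (L.smul_mem c hφ)
  intro φ hφ
  have h₁ := key φ hφ
  have h₂ := key (-φ) (L.neg_mem hφ)
  rw [inner_neg_right] at h₂
  linarith

lemma inner_gradient_nonpos_of_isLocalMaxOn [CompleteSpace X] {E : X → ℝ} {L : Submodule ℝ X}
    {u x : X} (hx : x ∈ halfspaceCone L u) (h : IsLocalMaxOn E (halfspaceCone L u) x)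
    (hE : DifferentiableAt ℝ E x) : ⟪gradient E x, u⟫ ≤ 0 := by
  refine h.inner_gradient_nonpos hE fun c hc => ?_
  obtain ⟨t, ht, w, hw, rfl⟩ := hx
  exact ⟨t + c, by positivity, w, hw, by rw [add_smul]; abel⟩

lemma one_le_norm_sub_smul {v g : X} {α : ℝ} (hv : ‖v‖ = 1) (hg : ⟪g, v⟫ ≤ 0) (hα : 0 ≤ α) :
    1 ≤ ‖v - α • g‖ := by
  have h : ‖v - α • g‖ ^ 2 = 1 - 2 * (α * ⟪g, v⟫) + ‖α • g‖ ^ 2 := by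
    rw [norm_sub_sq_real, hv, inner_smul_right, real_inner_comm, one_pow]
  have h₁ : α * ⟪g, v⟫ ≤ 0 := mul_nonpos_of_nonneg_of_nonpos hα hg
  nlinarith [sq_nonneg ‖α • g‖, norm_nonneg (v - α • g)]

lemma stepv_mem_V0 {L : Submodule ℝ X} {v0L v g : X} {α : ℝ} (hv : v ∈ V0 L v0L)
    (hgL : g ∈ Lᗮ) (hg : ⟪g, v⟫ ≤ 0) (hα : 0 ≤ α) : stepv v g α ∈ V0 L v0L := by
  have hN := one_le_norm_sub_smul hv.1 hg hα
  obtain ⟨-, w, hw, τ, hτ0, hτ1, hvw⟩ := hv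
  refine ⟨?_, ‖v - α • g‖⁻¹ • (w - α • g), ?_, ‖v - α • g‖⁻¹ * τ, by positivity, ?_, ?_⟩
  · rw [stepv, norm_smul, norm_inv, norm_norm, inv_mul_cancel₀ (by positivity)]
  · exact Submodule.smul_mem _ _ (Submodule.sub_mem _ hw (Submodule.smul_mem _ _ hgL))
  · exact mul_le_one₀ (inv_le_one_of_one_le₀ hN) hτ0 hτ1
  · rw [stepv, mul_smul, ← smul_add]
    congr 1
    rw [hvw]
    abel

lemma starProjection_orthogonal_add_smul {L : Submodule ℝ X} [FiniteDimensional ℝ L] {v0L w : X}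
    (hv0L : v0L ∈ L) (hw : w ∈ Lᗮ) (τ : ℝ) : Lᗮ.starProjection (w + τ • v0L) = w := by
  rw [map_add, Submodule.starProjection_eq_self_iff.mpr hw,
    (Submodule.starProjection_apply_eq_zero_iff Lᗮ).mpr, add_zero]
  exact Submodule.le_orthogonal_orthogonal L (L.smul_mem τ hv0L)

lemma norm_sq_of_add_smul_mem {L : Submodule ℝ X} {v0L w : X} (hv0L : v0L ∈ L) (hw : w ∈ Lᗮ)
    {τ : ℝ} (h : ‖w + τ • v0L‖ = 1) : ‖w‖ ^ 2 = 1 - τ ^ 2 * ‖v0L‖ ^ 2 := by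
  have h₁ := norm_add_sq_eq_norm_sq_add_norm_sq_of_inner_eq_zero w (τ • v0L)
    (Submodule.inner_left_of_mem_orthogonal (L.smul_mem τ hv0L) hw)
  rw [h, norm_smul, Real.norm_eq_abs] at h₁
  nlinarith [sq_abs τ]

lemma starProjection_ne_zero_of_mem_V0 {L : Submodule ℝ X} [FiniteDimensional ℝ L] {v0L v : X}
    (hv0L : v0L ∈ L) (hlt : ‖v0L‖ < 1) (hv : v ∈ V0 L v0L) : Lᗮ.starProjection v ≠ 0 := by
  obtain ⟨hn, w, hw, τ, hτ0, hτ1, rfl⟩ := hv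
  rw [starProjection_orthogonal_add_smul hv0L hw]
  rintro rfl
  rw [zero_add, norm_smul, Real.norm_of_nonneg hτ0] at hn
  nlinarith [norm_nonneg v0L]

lemma starProjection_smul_add {L : Submodule ℝ X} [FiniteDimensional ℝ L] {v w : X} (t : ℝ)
    (hw : w ∈ L) : Lᗮ.starProjection (t • v + w) = t • Lᗮ.starProjection v := by
  have h : Lᗮ.starProjection w = 0 := (Submodule.starProjection_apply_eq_zero_iff Lᗮ).mpr
    (Submodule.le_orthogonal_orthogonal L hw)
  rw [map_add, map_smul, h, add_zero]

/-- The coefficient of `v` in `t • v + w` is determined by the components orthogonal to `L`. -/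
lemma eq_norm_starProjection_div {L : Submodule ℝ X} [FiniteDimensional ℝ L] {v w : X} {t : ℝ}
    (hv : Lᗮ.starProjection v ≠ 0) (ht : 0 ≤ t) (hw : w ∈ L) :
    t = ‖Lᗮ.starProjection (t • v + w)‖ / ‖Lᗮ.starProjection v‖ := by
  rw [starProjection_smul_add t hw, norm_smul, Real.norm_of_nonneg ht,
    mul_div_cancel_right₀ _ (norm_ne_zero_iff.mpr hv)]

lemma continuous_gradient [CompleteSpace X] {E : X → ℝ} (hE : ContDiff ℝ 1 E) :
    Continuous (gradient E) :=
  (InnerProductSpace.toDual ℝ X).symm.continuous.comp (hE.continuous_fderiv one_ne_zero)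

/-- The mean value theorem on a convex set, in terms of the gradient. -/
lemma le_sub_of_le_inner_gradient [CompleteSpace X] {E : X → ℝ} (hE : Differentiable ℝ E)
    {s : Set X} (hs : Convex ℝ s) {x g : X} {a c : ℝ} (hx : x ∈ s) (hy : x + a • g ∈ s)
    (h : ∀ ξ ∈ s, c ≤ a * ⟪gradient E ξ, g⟫) : c ≤ E (x + a • g) - E x := by
  obtain ⟨ξ, hξ, h₁⟩ := domain_mvt (fun z _ => (hE z).hasFDerivAt.hasFDerivWithinAt) hs hx hy
  rw [h₁]
  refine (h ξ (hs.segment_subset hx hy hξ)).trans_eq ?_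
  rw [add_sub_cancel_left, map_smul, gradient, InnerProductSpace.toDual_symm_apply, smul_eq_mul]

/-- The coefficient in a continuous peak selection is continuous. -/
lemma continuousOn_coeff_V0 {L : Submodule ℝ X} [FiniteDimensional ℝ L] {v0L : X}
    (hv0L : v0L ∈ L) (hlt : ‖v0L‖ < 1) {p : X → X} {t : X → ℝ} {wL : X → X}
    (hdecomp : ∀ u : X, ‖u‖ = 1 → p u = t u • u + wL u ∧ 0 ≤ t u ∧ wL u ∈ L)
    (hpc : ContinuousOn p (V0 L v0L)) : ContinuousOn t (V0 L v0L) := by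
  have h : ContinuousOn (fun v => ‖Lᗮ.starProjection (p v)‖ / ‖Lᗮ.starProjection v‖)
      (V0 L v0L) := by
    refine ContinuousOn.div ?_ ?_ ?_
    · exact (Lᗮ.starProjection.continuous.comp_continuousOn hpc).norm
    · exact Lᗮ.starProjection.continuous.norm.continuousOn
    · exact fun v hv => norm_ne_zero_iff.mpr (starProjection_ne_zero_of_mem_V0 hv0L hlt hv)
  refine h.congr fun v hv => ?_
  obtain ⟨h₁, h₂, h₃⟩ := hdecomp v hv.1
  have := eq_norm_starProjection_div (starProjection_ne_zero_of_mem_V0 hv0L hlt hv) h₂ h₃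
  rwa [← h₁] at this

lemma continuousAt_stepv {v g : X} {α : ℝ} (h : v - α • g ≠ 0) :
    ContinuousAt (fun q : X × X × ℝ => stepv q.1 q.2.1 q.2.2) (v, g, α) := by
  unfold stepv
  refine ContinuousAt.smul (ContinuousAt.inv₀ ?_ (by simpa using h)) ?_ <;> fun_prop

/-- Uniform sufficient decrease near a point of `V₀` whose peak is not critical. -/
lemma eventually_peak_descent [CompleteSpace X] {E : X → ℝ} (hE : ContDiff ℝ 1 E)
    {L : Submodule ℝ X} [FiniteDimensional ℝ L] {v0L : X} (hv0L : v0L ∈ L) (hlt : ‖v0L‖ < 1)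
    {p : X → X}
    (hpsel : ∀ u : X, ‖u‖ = 1 →
      p u ∈ halfspaceCone L u ∧ IsLocalMaxOn E (halfspaceCone L u) (p u))
    {t : X → ℝ} {wL : X → X}
    (hdecomp : ∀ u : X, ‖u‖ = 1 → p u = t u • u + wL u ∧ 0 ≤ t u ∧ wL u ∈ L)
    (hpc : ContinuousOn p (V0 L v0L)) {σ : ℝ} (hσ : σ < 1) {vs : X} (hvs : vs ∈ V0 L v0L)
    (hts : 0 < t vs) (hgs : gradient E (p vs) ≠ 0) :
    ∀ᶠ q : X × ℝ in 𝓝[V0 L v0L] vs ×ˢ 𝓝[≥] 0,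
      E (p (stepv q.1 (gradient E (p q.1)) q.2)) ≤
        E (p q.1) - σ * q.2 * t q.1 * ‖gradient E (p q.1)‖ ^ 2 := by
  have hED : Differentiable ℝ E := hE.differentiable one_ne_zero
  have hgc : ContinuousOn (fun v => gradient E (p v)) (V0 L v0L) :=
    (continuous_gradient hE).comp_continuousOn hpc
  have htc := continuousOn_coeff_V0 hv0L hlt hdecomp hpc
  have hgL : ∀ v ∈ V0 L v0L, gradient E (p v) ∈ Lᗮ := fun v hv =>
    gradient_mem_orthogonal_of_isLocalMaxOn (hpsel v hv.1).1 (hpsel v hv.1).2 (hED _)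
  have hgv : ∀ v ∈ V0 L v0L, ⟪gradient E (p v), v⟫ ≤ 0 := fun v hv =>
    inner_gradient_nonpos_of_isLocalMaxOn (hpsel v hv.1).1 (hpsel v hv.1).2 (hED _)
  have hstep : ∀ v ∈ V0 L v0L, ∀ a : ℝ, 0 ≤ a →
      stepv v (gradient E (p v)) a ∈ V0 L v0L := fun v hv a ha =>
    stepv_mem_V0 hv (hgL v hv) (hgv v hv) ha
  have hN : ∀ v ∈ V0 L v0L, ∀ a : ℝ, 0 ≤ a → 1 ≤ ‖v - a • gradient E (p v)‖ :=
    fun v hv a ha => one_le_norm_sub_smul hv.1 (hgv v hv) ha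
  set l : Filter (X × ℝ) := 𝓝[V0 L v0L] vs ×ˢ 𝓝[≥] 0
  have hl₁ : Tendsto Prod.fst l (𝓝[V0 L v0L] vs) := tendsto_fst
  have hl₂ : Tendsto Prod.snd l (𝓝 (0 : ℝ)) := tendsto_snd.mono_right nhdsWithin_le_nhds
  have hl₁' : Tendsto Prod.fst l (𝓝 vs) := hl₁.mono_right nhdsWithin_le_nhds
  have hgl : Tendsto (fun q : X × ℝ => gradient E (p q.1)) l (𝓝 (gradient E (p vs))) :=
    (hgc vs hvs).tendsto.comp hl₁
  have hmem : ∀ᶠ q in l, q.1 ∈ V0 L v0L ∧ 0 ≤ q.2 :=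
    (hl₁.eventually self_mem_nhdsWithin).and (tendsto_snd.eventually self_mem_nhdsWithin)
  have hstep₀ : stepv vs (gradient E (p vs)) 0 = vs := by simp [stepv, hvs.1]
  have hvs0 : vs - (0 : ℝ) • gradient E (p vs) ≠ 0 := by
    rw [← norm_pos_iff]; simp [hvs.1]
  have hsl : Tendsto (fun q : X × ℝ => stepv q.1 (gradient E (p q.1)) q.2) l
      (𝓝[V0 L v0L] vs) := by
    refine tendsto_nhdsWithin_iff.mpr ⟨?_, hmem.mono fun q hq => hstep q.1 hq.1 q.2 hq.2⟩
    have := (continuousAt_stepv hvs0).tendsto.comp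
      (hl₁'.prodMk_nhds (hgl.prodMk_nhds hl₂))
    rwa [hstep₀] at this
  have hNl : Tendsto (fun q : X × ℝ => ‖q.1 - q.2 • gradient E (p q.1)‖) l (𝓝 1) := by
    have := (hl₁'.sub (hl₂.smul hgl)).norm
    simpa [hvs.1] using this
  -- the rate of decrease is uniform near `(vs, 0)` and `p vs`
  have hrate : ∀ᶠ q : (X × ℝ) × X in l ×ˢ 𝓝 (p vs),
      σ * t q.1.1 * ‖gradient E (p q.1.1)‖ ^ 2 <
        t (stepv q.1.1 (gradient E (p q.1.1)) q.1.2) / ‖q.1.1 - q.1.2 • gradient E (p q.1.1)‖ *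
          ⟪gradient E q.2, gradient E (p q.1.1)⟫ := by
    have hA : Tendsto (fun q : (X × ℝ) × X => σ * t q.1.1 * ‖gradient E (p q.1.1)‖ ^ 2)
        (l ×ˢ 𝓝 (p vs)) (𝓝 (σ * t vs * ‖gradient E (p vs)‖ ^ 2)) :=
      (((((htc vs hvs).tendsto.comp hl₁).const_mul σ).mul (hgl.norm.pow 2))).comp tendsto_fst
    have hB : Tendsto (fun q : (X × ℝ) × X =>
        t (stepv q.1.1 (gradient E (p q.1.1)) q.1.2) / ‖q.1.1 - q.1.2 • gradient E (p q.1.1)‖ *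
          ⟪gradient E q.2, gradient E (p q.1.1)⟫) (l ×ˢ 𝓝 (p vs))
        (𝓝 (t vs / 1 * ⟪gradient E (p vs), gradient E (p vs)⟫)) := by
      refine Tendsto.mul (Tendsto.comp
        (((htc vs hvs).tendsto.comp hsl).div hNl one_ne_zero) tendsto_fst) (Tendsto.inner ?_ ?_)
      · exact ((continuous_gradient hE).tendsto _).comp tendsto_snd
      · exact hgl.comp tendsto_fst
    refine hA.eventually_lt hB ?_
    rw [real_inner_self_eq_norm_sq, div_one, mul_assoc]
    have : 0 < t vs * ‖gradient E (p vs)‖ ^ 2 := by positivity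
    nlinarith
  obtain ⟨P, hP, Q, hQ, hPQ⟩ := eventually_prod_iff.mp hrate
  obtain ⟨r, hr, hrQ⟩ := Metric.eventually_nhds_iff_ball.mp hQ
  have hball : ∀ᶠ q in l, p (stepv q.1 (gradient E (p q.1)) q.2) ∈ Metric.ball (p vs) r :=
    ((hpc vs hvs).tendsto.comp hsl).eventually (Metric.ball_mem_nhds _ hr)
  -- replace the condition at `β` by the condition on `[0, β]`
  obtain ⟨A, hA, B, hB, hAB⟩ := eventually_prod_iff.mp (hP.and (hball.and hmem))
  obtain ⟨b, hb, hbB⟩ := mem_nhdsGE_iff_exists_Ico_subset.mp hB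
  refine eventually_prod_iff.mpr ⟨A, hA, fun a => a ∈ Ico 0 b, Ico_mem_nhdsGE hb, ?_⟩
  intro v hv β hβ
  have hgood := fun a (ha : a ∈ Ico 0 b) => hAB hv (hbB ha)
  have hvV : v ∈ V0 L v0L := (hgood β hβ).2.2.1
  set g := gradient E (p v)
  set c := σ * t v * ‖g‖ ^ 2 with hc
  set N : ℝ → ℝ := fun a => ‖v - a • g‖
  have hNpos : ∀ a, 0 ≤ a → 0 < N a := fun a ha => one_pos.trans_le (hN v hvV a ha)
  have hsc : ContinuousOn (fun a => stepv v g a) (Icc 0 β) := by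
    intro a ha
    have h := (continuousAt_stepv (norm_pos_iff.mp (hNpos a ha.1))).comp
      (f := fun a : ℝ => (v, g, a)) (by fun_prop)
    exact h.continuousWithinAt
  have hsm : MapsTo (fun a => stepv v g a) (Icc 0 β) (V0 L v0L) := fun a ha =>
    hstep v hvV a ha.1
  have hpsc : ContinuousOn (fun a => p (stepv v g a)) (Icc 0 β) := hpc.comp hsc hsm
  have hfc : ContinuousOn (fun a => E (p (stepv v g a))) (Icc 0 β) :=
    hE.continuous.comp_continuousOn hpsc
  have hslope : ∀ x ∈ Ico 0 β, ∀ᶠ z in 𝓝[>] x,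
      E (p (stepv v g z)) - E (p (stepv v g x)) ≤ -c * (z - x) := by
    intro x hx
    have hIcc : Icc 0 β ∈ 𝓝[>] x :=
      mem_of_superset (Ioc_mem_nhdsGT hx.2) fun z hz => ⟨hx.1.trans hz.1.le, hz.2⟩
    have hle : 𝓝[>] x ≤ 𝓝[Icc 0 β] x :=
      le_inf nhdsWithin_le_nhds (le_principal_iff.mpr hIcc)
    have hxI : x ∈ Icc 0 β := ⟨hx.1, hx.2.le⟩
    set s : ℝ → ℝ := fun z => t (stepv v g z) / N z * (z - x) with hs
    have hsx : Tendsto s (𝓝[>] x) (𝓝 0) := by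
      have h₁ := ((htc.comp hsc hsm x hxI).tendsto.mono_left hle)
      have h₂ : Tendsto N (𝓝[>] x) (𝓝 (N x)) :=
        (Continuous.tendsto (by fun_prop) x).mono_left nhdsWithin_le_nhds
      have h₃ : Tendsto (fun z => z - x) (𝓝[>] x) (𝓝 (x - x)) :=
        (Continuous.tendsto (by fun_prop) x).mono_left nhdsWithin_le_nhds
      have := (h₁.div h₂ (hNpos x hx.1).ne').mul h₃
      simpa using this
    have hpx : Tendsto (fun z => p (stepv v g z)) (𝓝[>] x) (𝓝 (p (stepv v g x))) :=
      (hpsc x hxI).tendsto.mono_left hle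
    have hy : Tendsto (fun z => p (stepv v g z) + s z • g) (𝓝[>] x)
        (𝓝 (p (stepv v g x))) := by
      simpa using hpx.add (hsx.smul_const g)
    have hycone : ∀ z ∈ Icc 0 β,
        p (stepv v g z) + s z • g ∈ halfspaceCone L (stepv v g x) := by
      intro z hz
      obtain ⟨h₁, h₂, h₃⟩ := hdecomp (stepv v g z) (hstep v hvV z hz.1).1
      have hNx := hNpos x hx.1
      have hNz := hNpos z hz.1
      refine ⟨t (stepv v g z) / N z * N x, by positivity, wL (stepv v g z), h₃, ?_⟩
      have e₁ : N x • stepv v g x = v - x • g := smul_inv_smul₀ hNx.ne' _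
      have e₂ : t (stepv v g z) • stepv v g z =
          t (stepv v g z) • (N z)⁻¹ • (v - z • g) := rfl
      rw [mul_smul _ (N x), e₁, h₁, e₂]
      simp only [hs, div_eq_mul_inv]
      module
    have hball_x : ∀ᶠ z in 𝓝[>] x, p (stepv v g z) + s z • g ∈ Metric.ball (p vs) r :=
      hy.eventually (Metric.isOpen_ball.mem_nhds (hgood x ⟨hx.1, hx.2.trans hβ.2⟩).2.1)
    have hmax : ∀ᶠ z in 𝓝[>] x, E (p (stepv v g z) + s z • g) ≤ E (p (stepv v g x)) := by
      have hw : Tendsto (fun z => p (stepv v g z) + s z • g) (𝓝[>] x)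
          (𝓝[halfspaceCone L (stepv v g x)] (p (stepv v g x))) :=
        tendsto_nhdsWithin_iff.mpr ⟨hy, mem_of_superset hIcc hycone⟩
      exact hw.eventually (hpsel _ (hstep v hvV x hx.1).1).2
    filter_upwards [hball_x, hmax, hIcc, self_mem_nhdsWithin] with z hz₁ hz₂ hz₃ hz₄
    have hzx : 0 < z - x := sub_pos.mpr hz₄
    obtain ⟨hzP, hzb, -⟩ := hgood z ⟨hz₃.1, hz₃.2.trans_lt hβ.2⟩
    have := le_sub_of_le_inner_gradient hED (convex_ball (p vs) r) (c := c * (z - x)) hzb hz₁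
      (fun ξ hξ => by
        have := (hPQ hzP (hrQ ξ hξ)).le
        calc c * (z - x) ≤ _ * (z - x) := mul_le_mul_of_nonneg_right this hzx.le
          _ = _ := by simp only [hs]; ring)
    linarith
  have := image_le_of_liminf_slope_right_le_deriv_boundary (f := fun a => E (p (stepv v g a)))
    (a := 0) (b := β) (B := fun a => E (p v) - c * a) (B' := fun _ => -c) hfc
    (by
      have : stepv v g 0 = v := by simp [stepv, hvV.1]
      simp [this])
    (by fun_prop)
    (fun x _ => by
      have := ((hasDerivAt_id x).const_mul c).const_sub (E (p v))
      simpa using this.hasDerivWithinAt)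
    (fun x hx r hr => by
      refine Eventually.frequently ?_
      filter_upwards [hslope x hx, self_mem_nhdsWithin] with z hz hzx
      refine lt_of_le_of_lt ?_ hr
      rw [slope_def_field, div_le_iff₀ (sub_pos.mpr hzx)]
      exact hz)
    (x := β) ⟨hβ.1, le_rfl⟩
  refine this.trans_eq ?_
  simp only [hc]
  ring

/-- If the peaks along a sequence in `V₀` converge and their coefficients stay away from zero,
then the limit is off `L` and a subsequence converges in `V₀`. -/
lemma exists_subseq_tendsto_V0 {L : Submodule ℝ X} [FiniteDimensional ℝ L] {v0L : X}
    (hv0L : v0L ∈ L) (hlt : ‖v0L‖ < 1) {v w : ℕ → X} {t : ℕ → ℝ} {δ : ℝ} (hδ : 0 < δ)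
    (ht : ∀ i, δ ≤ t i) (hw : ∀ i, w i ∈ L) (hv : ∀ i, v i ∈ V0 L v0L) {u : X}
    (hu : Tendsto (fun i => t i • v i + w i) atTop (𝓝 u)) :
    u ∉ L ∧ ∃ vs ∈ V0 L v0L, ∃ ψ : ℕ → ℕ, StrictMono ψ ∧ Tendsto (v ∘ ψ) atTop (𝓝 vs) := by
  choose hn z hz τ hτ0 hτ1 hvz using hv
  have hPv : ∀ i, Lᗮ.starProjection (v i) = z i := fun i => by
    rw [hvz i, starProjection_orthogonal_add_smul hv0L (hz i)]
  have hPu : Tendsto (fun i => t i • z i) atTop (𝓝 (Lᗮ.starProjection u)) := by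
    have := (Lᗮ.starProjection.continuous.tendsto u).comp hu
    refine this.congr fun i => ?_
    rw [Function.comp_apply, starProjection_smul_add _ (hw i), hPv]
  obtain ⟨τs, hτs, ψ, hψ, hτψ⟩ :=
    isCompact_Icc.tendsto_subseq (fun i => (⟨hτ0 i, hτ1 i⟩ : τ i ∈ Icc (0 : ℝ) 1))
  have hzn : ∀ i, ‖z i‖ = √(1 - τ i ^ 2 * ‖v0L‖ ^ 2) := fun i => by
    rw [← norm_sq_of_add_smul_mem hv0L (hz i) (hvz i ▸ hn i), Real.sqrt_sq (norm_nonneg _)]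
  set n := √(1 - τs ^ 2 * ‖v0L‖ ^ 2)
  have hnpos : 0 < n := by
    apply Real.sqrt_pos.mpr
    have h₁ : τs ^ 2 ≤ 1 := pow_le_one₀ hτs.1 hτs.2
    have h₂ : ‖v0L‖ ^ 2 < 1 := pow_lt_one₀ (norm_nonneg _) hlt two_ne_zero
    nlinarith [sq_nonneg ‖v0L‖]
  have hzl : Tendsto (fun i => ‖z (ψ i)‖) atTop (𝓝 n) := by
    simp only [hzn]
    exact ((((hτψ.pow 2).mul_const _).const_sub 1).sqrt)
  have htl : Tendsto (fun i => t (ψ i)) atTop (𝓝 (‖Lᗮ.starProjection u‖ / n)) := by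
    have h₁ := (hPu.comp hψ.tendsto_atTop).norm.div hzl hnpos.ne'
    refine h₁.congr' ?_
    filter_upwards [hzl.eventually (lt_mem_nhds hnpos)] with i hi
    simp only [Function.comp_apply, Pi.div_apply]
    rw [norm_smul, Real.norm_of_nonneg (hδ.le.trans (ht _)), mul_div_cancel_right₀ _ hi.ne']
  set ts := ‖Lᗮ.starProjection u‖ / n
  have hts : δ ≤ ts := ge_of_tendsto' htl fun i => ht _
  have hts0 : 0 < ts := hδ.trans_le hts
  refine ⟨fun huL => ?_, ?_⟩
  · have : Lᗮ.starProjection u = 0 := (Submodule.starProjection_apply_eq_zero_iff Lᗮ).mpr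
      (Submodule.le_orthogonal_orthogonal L huL)
    simp [ts, this] at hts0
  have hzs : Tendsto (fun i => z (ψ i)) atTop (𝓝 (ts⁻¹ • Lᗮ.starProjection u)) := by
    refine ((htl.inv₀ hts0.ne').smul (hPu.comp hψ.tendsto_atTop)).congr fun i => ?_
    exact inv_smul_smul₀ (hδ.trans_le (ht _)).ne' _
  have hvs : Tendsto (v ∘ ψ) atTop (𝓝 (ts⁻¹ • Lᗮ.starProjection u + τs • v0L)) := by
    refine (hzs.add (hτψ.smul_const v0L)).congr fun i => ?_
    exact (hvz (ψ i)).symm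
  refine ⟨_, ⟨?_, _, ?_, τs, hτs.1, hτs.2, rfl⟩, ψ, hψ, hvs⟩
  · exact tendsto_nhds_unique hvs.norm (by simp [hn])
  · exact Submodule.smul_mem _ _ (Submodule.starProjection_apply_mem _ _)

end LocalMinimax

/-- In a nonmonotone line search with memory `M`, block maxima decrease by the decrease at the
step that produces them. -/
lemma nonmonotone_block_max_le {M : ℕ} {e d : ℕ → ℝ} (hd : ∀ k, 0 ≤ d k)
    (hstep : ∀ k, ∀ C : ℝ, (∀ i < min M (k + 1), e (k - i) ≤ C) → e (k + 1) ≤ C - d k)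
    {μ : ℕ → ℕ} (hμ0 : μ 0 = 0)
    (hμmem : ∀ j : ℕ, 1 ≤ j → (j - 1) * M + 1 ≤ μ j ∧ μ j ≤ j * M)
    (hμmax : ∀ j : ℕ, 1 ≤ j → ∀ i : ℕ, (j - 1) * M + 1 ≤ i → i ≤ j * M → e i ≤ e (μ j))
    (j : ℕ) : e (μ (j + 1)) ≤ e (μ j) - d (μ (j + 1) - 1) := by
  have hprev : ∀ i, i ≤ j * M → j * M < i + M → e i ≤ e (μ j) := by
    intro i h₁ h₂
    rcases Nat.eq_zero_or_pos j with rfl | hj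
    · have : i = 0 := by simpa using h₁
      rw [this, hμ0]
    · refine hμmax j hj i ?_ h₁
      obtain ⟨j, rfl⟩ : ∃ j', j = j' + 1 := ⟨j - 1, by omega⟩
      rw [Nat.add_sub_cancel]
      rw [Nat.succ_mul] at h₂
      omega
  have hblock : ∀ n < M, e (j * M + n + 1) ≤ e (μ j) - d (j * M + n) := by
    intro n
    induction n using Nat.strong_induction_on with
    | _ n ih =>
      intro hn
      refine hstep _ _ fun i hi => ?_
      rcases le_or_gt (j * M + n - i) (j * M) with h | h
      · exact hprev _ h (by omega)
      · have h₁ := ih (n - i - 1) (by omega) (by omega)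
        have h₂ : j * M + (n - i - 1) + 1 = j * M + n - i := by omega
        rw [h₂] at h₁
        linarith [hd (j * M + (n - i - 1))]
  obtain ⟨h₁, h₂⟩ := hμmem (j + 1) (by omega)
  rw [Nat.add_sub_cancel] at h₁
  rw [Nat.succ_mul] at h₂
  have := hblock (μ (j + 1) - 1 - j * M) (by omega)
  have e₁ : j * M + (μ (j + 1) - 1 - j * M) = μ (j + 1) - 1 := by omega
  have e₂ : μ (j + 1) - 1 + 1 = μ (j + 1) := by omega
  rwa [e₁, e₂] at this

/-- A nonnegative sequence dominated by the decrements of a sequence bounded below is summable. -/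
lemma summable_of_le_sub_succ {e d : ℕ → ℝ} (hd : ∀ j, 0 ≤ d j) (h : ∀ j, e (j + 1) ≤ e j - d j)
    (hb : BddBelow (range e)) : Summable d := by
  obtain ⟨b, hb⟩ := hb
  refine summable_of_sum_range_le (c := e 0 - b) hd fun n => ?_
  have h₁ : ∑ i ∈ Finset.range n, d i ≤ ∑ i ∈ Finset.range n, (e i - e (i + 1)) :=
    Finset.sum_le_sum fun i _ => by linarith [h i]
  rw [Finset.sum_range_sub'] at h₁
  linarith [hb (mem_range_self n)]

/-- Theorem 3.11: partial convergence of the normalized GLL-type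
nonmonotone LMM.  With `K = {μ_j − 1 : j = 1, 2, …}` (enumerated by
`j ↦ μ_{j+1} − 1`): (a) `∑_{k∈K} α_k ‖g_k‖² < ∞`; (b) every accumulation point of
`{w_k}_{k∈K}` is a critical point of `E` not in `L`; (c) if the whole sequence `{w_k}`
converges to `u_*`, then `u_* ∉ L` and `E'(u_*) = 0`.  (The maximum over
`j = 1, …, min{M,k+1}` of `E(p(v_{k+1−j}))` is written as the maximum over
`i = 0, …, min{M,k+1} − 1` of `E(p(v_{k−i}))`.) -/
theorem statement19
    {X : Type*} [NormedAddCommGroup X] [InnerProductSpace ℝ X] [CompleteSpace X]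
    (E : X → ℝ) (hE : ContDiff ℝ 1 E)
    (L : Submodule ℝ X) [FiniteDimensional ℝ L]
    (v0perp v0L : X) (hv0perp : v0perp ∈ Lᗮ) (hv0perp0 : v0perp ≠ 0) (hv0L : v0L ∈ L)
    (hv0norm : ‖v0perp + v0L‖ = 1)
    (p : X → X)
    (hpsel : ∀ u : X, ‖u‖ = 1 →
      p u ∈ halfspaceCone L u ∧ IsLocalMaxOn E (halfspaceCone L u) (p u))
    (t : X → ℝ) (wL : X → X)
    (hdecomp : ∀ u : X, ‖u‖ = 1 → p u = t u • u + wL u ∧ 0 ≤ t u ∧ wL u ∈ L)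
    (M : ℕ) (hM : 1 < M)
    (σ ρ : ℝ) (hσ : σ ∈ Set.Ioo (0 : ℝ) 1) (hρ : ρ ∈ Set.Ioo (0 : ℝ) 1)
    (lmin lmax : ℝ) (hlmin : 0 < lmin) (hlle : lmin ≤ lmax)
    (lam : ℕ → ℝ) (m : ℕ → ℕ) (α : ℕ → ℝ)
    (hlam : ∀ k, lam k ∈ Set.Icc lmin lmax)
    (v : ℕ → X)
    (hv00 : v 0 = v0perp + v0L)
    (hαdef : ∀ k, α k = lam k * ρ ^ m k)
    (hGLL : ∀ k : ℕ,
      E (p (stepv (v k) (gradient E (p (v k))) (α k))) ≤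
        (Finset.range (min M (k + 1))).sup'
            (Finset.nonempty_range_iff.mpr (by omega)) (fun i => E (p (v (k - i))))
          - σ * α k * t (v k) * ‖gradient E (p (v k))‖ ^ 2)
    (hmmin : ∀ k : ℕ, ∀ m' < m k,
      ¬ (E (p (stepv (v k) (gradient E (p (v k))) (lam k * ρ ^ m'))) ≤
        (Finset.range (min M (k + 1))).sup'
            (Finset.nonempty_range_iff.mpr (by omega)) (fun i => E (p (v (k - i))))
          - σ * (lam k * ρ ^ m') * t (v k) * ‖gradient E (p (v k))‖ ^ 2))
    (hrecv : ∀ k, v (k + 1) = stepv (v k) (gradient E (p (v k))) (α k))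
    (hV0 : ∀ k, v k ∈ V0 L v0L)
    (hpc : ContinuousOn p (V0 L v0L))
    (μ : ℕ → ℕ) (hμ0 : μ 0 = 0)
    (hμmem : ∀ j : ℕ, 1 ≤ j → (j - 1) * M + 1 ≤ μ j ∧ μ j ≤ j * M)
    (hμmax : ∀ j : ℕ, 1 ≤ j → ∀ i : ℕ, (j - 1) * M + 1 ≤ i → i ≤ j * M →
      E (p (v i)) ≤ E (p (v (μ j))))
    (δ : ℝ) (hδ : 0 < δ) (ht : ∀ j : ℕ, δ ≤ t (v (μ (j + 1) - 1)))
    (hbdd : BddBelow (Set.range fun j => E (p (v (μ j))))) :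
    Summable (fun j => α (μ (j + 1) - 1) * ‖gradient E (p (v (μ (j + 1) - 1)))‖ ^ 2) ∧
    (∀ u : X, (∃ φ : ℕ → ℕ, StrictMono φ ∧
        Tendsto (fun i => p (v (μ (φ i + 1) - 1))) atTop (nhds u)) →
      u ∉ L ∧ fderiv ℝ E u = 0) ∧
    (∀ ustar : X, Tendsto (fun k => p (v k)) atTop (nhds ustar) →
      ustar ∉ L ∧ fderiv ℝ E ustar = 0) := by
  have hED : Differentiable ℝ E := hE.differentiable one_ne_zero
  have hlt : ‖v0L‖ < 1 := by
    have h := norm_add_sq_eq_norm_sq_add_norm_sq_of_inner_eq_zero v0perp v0L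
      (Submodule.inner_left_of_mem_orthogonal hv0L hv0perp)
    rw [hv0norm] at h
    have := norm_pos_iff.mpr hv0perp0
    nlinarith [norm_nonneg v0L]
  have hαpos : ∀ k, 0 < α k := fun k => by
    rw [hαdef]
    exact mul_pos (hlmin.trans_le (hlam k).1) (pow_pos hρ.1 _)
  have hμlow : ∀ j, j ≤ μ (j + 1) - 1 := fun j => by
    have h := (hμmem (j + 1) (by omega)).1
    rw [Nat.add_sub_cancel] at h
    have := Nat.le_mul_of_pos_right j (by omega : 0 < M)
    omega
  have ht0 : ∀ k, 0 ≤ t (v k) := fun k => (hdecomp _ (hV0 k).1).2.1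
  have hdec : ∀ j, E (p (v (μ (j + 1)))) ≤ E (p (v (μ j))) -
      σ * α (μ (j + 1) - 1) * t (v (μ (j + 1) - 1)) *
        ‖gradient E (p (v (μ (j + 1) - 1)))‖ ^ 2 := by
    refine nonmonotone_block_max_le (e := fun k => E (p (v k)))
      (d := fun k => σ * α k * t (v k) * ‖gradient E (p (v k))‖ ^ 2) (fun k => ?_)
      (fun k C hC => ?_) hμ0 hμmem hμmax
    · have := hσ.1; have := hαpos k; have := ht0 k
      positivity
    · have h := hGLL k
      rw [← hrecv] at h
      refine h.trans (sub_le_sub_right (Finset.sup'_le _ _ fun i hi => ?_) _)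
      exact hC i (Finset.mem_range.mp hi)
  have hsum : Summable
      (fun j => α (μ (j + 1) - 1) * ‖gradient E (p (v (μ (j + 1) - 1)))‖ ^ 2) := by
    have hσδ : 0 < σ * δ := mul_pos hσ.1 hδ
    rw [← summable_mul_left_iff hσδ.ne']
    refine summable_of_le_sub_succ (e := fun j => E (p (v (μ j)))) (fun j => ?_) (fun j => ?_) hbdd
    · have := hαpos (μ (j + 1) - 1)
      positivity
    · refine (hdec j).trans (sub_le_sub_left ?_ _)
      have h₁ : 0 ≤ σ * (α (μ (j + 1) - 1) * ‖gradient E (p (v (μ (j + 1) - 1)))‖ ^ 2) := by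
        have := hσ.1; have := hαpos (μ (j + 1) - 1)
        positivity
      have := mul_le_mul_of_nonneg_left (ht j) h₁
      linarith
  have hacc : ∀ u : X, (∃ φ : ℕ → ℕ, StrictMono φ ∧
        Tendsto (fun i => p (v (μ (φ i + 1) - 1))) atTop (nhds u)) →
      u ∉ L ∧ fderiv ℝ E u = 0 := by
    rintro u ⟨φ, hφ, hu⟩
    set κ : ℕ → ℕ := fun i => μ (φ i + 1) - 1
    have hu' : Tendsto (fun i => t (v (κ i)) • v (κ i) + wL (v (κ i))) atTop (𝓝 u) :=
      hu.congr fun i => (hdecomp _ (hV0 _).1).1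
    obtain ⟨huL, vs, hvs, ψ, hψ, hvψ⟩ := exists_subseq_tendsto_V0 hv0L hlt hδ
      (t := fun i => t (v (κ i))) (v := fun i => v (κ i)) (w := fun i => wL (v (κ i)))
      (fun i => ht (φ i)) (fun i => (hdecomp _ (hV0 _).1).2.2) (fun i => hV0 _) hu'
    refine ⟨huL, ?_⟩
    have hvV : Tendsto (fun i => v (κ (ψ i))) atTop (𝓝[V0 L v0L] vs) :=
      tendsto_nhdsWithin_iff.mpr ⟨hvψ, Eventually.of_forall fun i => hV0 _⟩
    have hpu : p vs = u :=
      tendsto_nhds_unique ((hpc vs hvs).tendsto.comp hvV) (hu.comp hψ.tendsto_atTop)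
    have htvs : 0 < t vs := hδ.trans_le (ge_of_tendsto'
      ((continuousOn_coeff_V0 hv0L hlt hdecomp hpc vs hvs).tendsto.comp hvV)
      fun i => ht (φ (ψ i)))
    by_contra hcrit
    have hgs : gradient E (p vs) ≠ 0 := by
      rw [hpu, gradient]
      simpa using hcrit
    have hgl : Tendsto (fun i => ‖gradient E (p (v (κ (ψ i))))‖ ^ 2) atTop
        (𝓝 (‖gradient E (p vs)‖ ^ 2)) :=
      ((((continuous_gradient hE).tendsto _).comp
        ((hpc vs hvs).tendsto.comp hvV)).norm.pow 2)
    have hgs2 : 0 < ‖gradient E (p vs)‖ ^ 2 := by positivity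
    have hα0 : Tendsto (fun i => α (κ (ψ i))) atTop (𝓝 0) := by
      have h₁ := (hsum.tendsto_atTop_zero.comp (hφ.comp hψ).tendsto_atTop).div hgl hgs2.ne'
      rw [zero_div] at h₁
      refine h₁.congr' ?_
      filter_upwards [hgl.eventually (lt_mem_nhds hgs2)] with i hi
      exact mul_div_cancel_right₀ _ hi.ne'
    have hβ : Tendsto (fun i => α (κ (ψ i)) / ρ) atTop (𝓝[≥] 0) := by
      refine tendsto_nhdsWithin_iff.mpr ⟨by simpa using hα0.div_const ρ, ?_⟩
      exact Eventually.of_forall fun i => (div_pos (hαpos _) hρ.1).le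
    have hev := (hvV.prodMk hβ).eventually
      (eventually_peak_descent hE hv0L hlt hpsel hdecomp hpc hσ.2 hvs htvs hgs)
    obtain ⟨i, hi₁, hi₂⟩ := (hev.and (hα0.eventually (gt_mem_nhds hlmin))).exists
    set k := κ (ψ i)
    have hm : m k ≠ 0 := fun h => by
      rw [hαdef, h, pow_zero, mul_one] at hi₂
      exact absurd (hlam k).1 (not_le.mpr hi₂)
    have hαρ : α k / ρ = lam k * ρ ^ (m k - 1) := by
      rw [hαdef, div_eq_iff hρ.1.ne', mul_assoc, ← pow_succ, Nat.sub_add_cancel (by omega)]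
    simp only [hαρ] at hi₁
    refine hmmin k (m k - 1) (by omega) (hi₁.trans (sub_le_sub_right ?_ _))
    exact Finset.le_sup' (fun i => E (p (v (k - i)))) (b := 0)
      (Finset.mem_range.mpr (by omega))
  refine ⟨hsum, hacc, fun u hu => hacc u ⟨id, strictMono_id, ?_⟩⟩
  exact hu.comp (tendsto_atTop_mono hμlow tendsto_id)
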